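/- For t ∈ ℝ let θ_t ∈ P(ℝ³) be the line through (1,0,t) and let θ_∞ be the line through (0,0,1). There exists a free measure preserving action T of the integer Heisenberg group H₃(ℤ) on a σ-finite standard measure space (X, μ) with μ(X) = ∞ such that 𝓡(T) = {θ_l : l ∈ ℤ} ∪ {θ_∞}; consequently the set of evenly recurrent directions is 𝓔𝓡(T) = {θ_∞}, so 𝓡(T) ≠ 𝓔𝓡(T). -/

import Mathlib

open MeasureTheory Filter Set Topology

noncomputable section

instance : TopologicalSpace (Projectivization ℝ (ℝ × ℝ × ℝ)) :=
  inferInstanceAs (TopologicalSpace (Quotient _))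

/-- Multiplication of the (integer) Heisenberg group `H₃`, on triples. -/
def hMul (a b : ℤ × ℤ × ℤ) : ℤ × ℤ × ℤ :=
  (a.1 + b.1, a.2.1 + b.2.1, a.2.2 + b.2.2 + a.1 * b.2.1)

/-- The embedding of `H₃(ℤ)` into `H₃(ℝ)`. -/
def hCast (a : ℤ × ℤ × ℤ) : ℝ × ℝ × ℝ := ((a.1 : ℝ), (a.2.1 : ℝ), (a.2.2 : ℝ))

/-- The right-invariant metric on `H₃(ℝ)`:
`d((t₁,t₂,t₃),(t₁',t₂',t₃')) = |t₁−t₁'| + |t₂−t₂'| + |t₃−t₃'+t₂'(t₁'−t₁)|`. -/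
def hDist (t t' : ℝ × ℝ × ℝ) : ℝ :=
  |t.1 - t'.1| + |t.2.1 - t'.2.1| + |t.2.2 - t'.2.2 + t'.2.1 * (t'.1 - t.1)|

/-- The exponential map of `H₃(ℝ)`, identifying the Lie algebra with `ℝ³`:
`exp(α,β,γ) = (α, β, γ + αβ/2)`. -/
def hExp (v : ℝ × ℝ × ℝ) : ℝ × ℝ × ℝ := (v.1, v.2.1, v.2.2 + v.1 * v.2.1 / 2)

/-- The one-parameter subgroup `exp(θ)` of `H₃(ℝ)` associated with a line `θ ∈ P(ℝ³)`. -/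
def expLine (θ : Projectivization ℝ (ℝ × ℝ × ℝ)) : Set (ℝ × ℝ × ℝ) :=
  hExp '' (θ.submodule : Set (ℝ × ℝ × ℝ))

/-- `T` is a measure preserving action of `H₃(ℤ)` on `(X, μ)`. -/
def IsH3Action {X : Type*} [MeasurableSpace X] (μ : Measure X)
    (T : ℤ × ℤ × ℤ → X ≃ᵐ X) : Prop :=
  (∀ a b : ℤ × ℤ × ℤ, ∀ x : X, T (hMul a b) x = T a (T b x)) ∧
    ∀ a : ℤ × ℤ × ℤ, MeasurePreserving (T a) μ μ

/-- The action `T` of `H₃(ℤ)` is free. -/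
def IsH3Free {X : Type*} [MeasurableSpace X] (μ : Measure X)
    (T : ℤ × ℤ × ℤ → X ≃ᵐ X) : Prop :=
  ∀ a : ℤ × ℤ × ℤ, a ≠ 0 → ∀ᵐ x ∂μ, T a x ≠ x

/-- The action `T` of `H₃(ℤ)` is recurrent along the line `θ ∈ P(ℝ³)`. -/
def H3RecurrentAlong {X : Type*} [MeasurableSpace X] (μ : Measure X)
    (T : ℤ × ℤ × ℤ → X ≃ᵐ X) (θ : Projectivization ℝ (ℝ × ℝ × ℝ)) : Prop :=
  ∀ ε : ℝ, 0 < ε → ∀ A : Set X, MeasurableSet A → 0 < μ A →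
    ∃ γ : ℤ × ℤ × ℤ, γ ≠ 0 ∧ ∃ g ∈ expLine θ, hDist (hCast γ) g < ε ∧ 0 < μ (A ∩ T γ '' A)

/-- The set `𝓡(T)` of recurrent directions of an `H₃(ℤ)`-action. -/
def h3RecSet {X : Type*} [MeasurableSpace X] (μ : Measure X)
    (T : ℤ × ℤ × ℤ → X ≃ᵐ X) : Set (Projectivization ℝ (ℝ × ℝ × ℝ)) :=
  {θ | H3RecurrentAlong μ T θ}

/-- The action `T` of `H₃(ℤ)` is rigid along the line `θ ∈ P(ℝ³)`. -/
def H3RigidAlong {X : Type*} [MeasurableSpace X] (μ : Measure X)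
    (T : ℤ × ℤ × ℤ → X ≃ᵐ X) (θ : Projectivization ℝ (ℝ × ℝ × ℝ)) : Prop :=
  ∃ γ : ℕ → ℤ × ℤ × ℤ,
    Tendsto (fun n => ‖hCast (γ n)‖) atTop atTop ∧
    Tendsto (fun n => ⨅ g ∈ expLine θ, hDist (hCast (γ n)) g) atTop (𝓝 0) ∧
    ∀ A : Set X, MeasurableSet A → μ A < ⊤ →
      Tendsto (fun n => μ (A ∩ T (γ n) '' A)) atTop (𝓝 (μ A))

/-- The set `𝓡i(T)` of rigid directions of an `H₃(ℤ)`-action. -/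
def h3RigSet {X : Type*} [MeasurableSpace X] (μ : Measure X)
    (T : ℤ × ℤ × ℤ → X ≃ᵐ X) : Set (Projectivization ℝ (ℝ × ℝ × ℝ)) :=
  {θ | H3RigidAlong μ T θ}

/-- The adjoint action of `g ∈ H₃(ℝ)` on the Lie algebra `ℝ³`:
`(x,y,z)·(α,β,γ) = (α, β, γ + xβ − yα)`, as a linear map. -/
def adjLin (g : ℝ × ℝ × ℝ) : (ℝ × ℝ × ℝ) →ₗ[ℝ] (ℝ × ℝ × ℝ) where
  toFun v := (v.1, v.2.1, v.2.2 + g.1 * v.2.1 - g.2.1 * v.1)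
  map_add' v w := by
    refine Prod.ext_iff.mpr ⟨rfl, Prod.ext_iff.mpr ⟨rfl, ?_⟩⟩
    simp [Prod.fst_add, Prod.snd_add]
    ring
  map_smul' c v := by
    refine Prod.ext_iff.mpr ⟨rfl, Prod.ext_iff.mpr ⟨rfl, ?_⟩⟩
    simp [Prod.smul_fst, Prod.smul_snd, smul_eq_mul]
    ring

lemma adjLin_injective (g : ℝ × ℝ × ℝ) : Function.Injective (adjLin g) := by
  intro v w h
  have h' : (v.1, v.2.1, v.2.2 + g.1 * v.2.1 - g.2.1 * v.1) =
      (w.1, w.2.1, w.2.2 + g.1 * w.2.1 - g.2.1 * w.1) := h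
  obtain ⟨h1, h2, h3⟩ : v.1 = w.1 ∧ v.2.1 = w.2.1 ∧
      v.2.2 + g.1 * v.2.1 - g.2.1 * v.1 = w.2.2 + g.1 * w.2.1 - g.2.1 * w.1 := by
    simpa [Prod.ext_iff] using h'
  have h4 : v.2.2 = w.2.2 := by rw [h1, h2] at h3; linarith
  exact Prod.ext_iff.mpr ⟨h1, Prod.ext_iff.mpr ⟨h2, h4⟩⟩

/-- The adjoint action of `H₃(ℝ)` on the projective space `P(ℝ³)`. -/
def adjProj (g : ℝ × ℝ × ℝ) :
    Projectivization ℝ (ℝ × ℝ × ℝ) → Projectivization ℝ (ℝ × ℝ × ℝ) :=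
  Projectivization.map (adjLin g) (adjLin_injective g)

/-- The action `T` of `H₃(ℤ)` is evenly recurrent along `θ`: it is recurrent along every line
in the `H₃(ℝ)`-orbit of `θ` under the adjoint action. -/
def H3EvenRecurrentAlong {X : Type*} [MeasurableSpace X] (μ : Measure X)
    (T : ℤ × ℤ × ℤ → X ≃ᵐ X) (θ : Projectivization ℝ (ℝ × ℝ × ℝ)) : Prop :=
  ∀ g : ℝ × ℝ × ℝ, H3RecurrentAlong μ T (adjProj g θ)

/-- The action `T` of `H₃(ℤ)` is evenly rigid along `θ`. -/
def H3EvenRigidAlong {X : Type*} [MeasurableSpace X] (μ : Measure X)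
    (T : ℤ × ℤ × ℤ → X ≃ᵐ X) (θ : Projectivization ℝ (ℝ × ℝ × ℝ)) : Prop :=
  ∀ g : ℝ × ℝ × ℝ, H3RigidAlong μ T (adjProj g θ)

/-- The line `θ_t ∈ P(ℝ³)` through the vector `(1, 0, t)`. -/
def thetaLine (t : ℝ) : Projectivization ℝ (ℝ × ℝ × ℝ) :=
  Projectivization.mk ℝ (1, 0, t) (by simp [Prod.ext_iff])

/-- The line `θ_∞ ∈ P(ℝ³)` through the vector `(0, 0, 1)`. -/
def thetaInf : Projectivization ℝ (ℝ × ℝ × ℝ) :=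
  Projectivization.mk ℝ (0, 0, 1) (by simp [Prod.ext_iff])

/-- The vector of `ℤ²` spanning the line of slope `l`, or the vertical line. -/
def slopeVec : Option ℤ → ℤ × ℤ
  | none => (0, 1)
  | some l => (1, l)

/-- An enumeration of the vectors `slopeVec o` in which each of them occurs infinitely often. -/
def dirSeq (i : ℕ) : ℤ × ℤ := slopeVec (Denumerable.ofNat (Option ℤ) i.unpair.1)

/-- The `ℓ¹` norm of `dirSeq i`. -/
def dirNorm (i : ℕ) : ℕ := (dirSeq i).1.natAbs + (dirSeq i).2.natAbs

/-- A sequence of integers, each dividing the next, growing much faster than `dirNorm`. -/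
def modulus : ℕ → ℕ
  | 0 => 1
  | k + 1 => modulus k * ((k + 2) * (1 + dirNorm k))

/-- The `ℓ¹` size of the vectors `modulus i • dirSeq i` with `i < k`. -/
def sizeSum (k : ℕ) : ℕ := ∑ i ∈ Finset.range k, modulus i * dirNorm i

lemma dirSeq_ne_zero (i : ℕ) : (dirSeq i).1 ≠ 0 ∨ (dirSeq i).2 ≠ 0 := by
  unfold dirSeq
  cases Denumerable.ofNat (Option ℤ) i.unpair.1 <;> simp [slopeVec]

lemma exists_dirSeq_eq (o : Option ℤ) (K : ℕ) : ∃ i, K ≤ i ∧ dirSeq i = slopeVec o :=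
  ⟨Nat.pair (Encodable.encode o) K, Nat.right_le_pair _ _, by simp [dirSeq]⟩

lemma succ_le_modulus (k : ℕ) : k + 1 ≤ modulus k := by
  induction k with
  | zero => simp [modulus]
  | succ k ih =>
    rw [modulus]
    have : 1 ≤ modulus k := by omega
    calc k + 1 + 1 = 1 * ((k + 2) * 1) := by ring
      _ ≤ _ := by gcongr; omega

instance (k : ℕ) : NeZero (modulus k) := ⟨by have := succ_le_modulus k; omega⟩

lemma modulus_dvd {j k : ℕ} (h : j ≤ k) : modulus j ∣ modulus k := by
  induction k, h using Nat.le_induction with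
  | base => exact dvd_rfl
  | succ k _ ih => exact ih.trans (Dvd.intro _ rfl)

lemma succ_mul_sizeSum_le (k : ℕ) : (k + 1) * sizeSum k ≤ modulus k := by
  induction k with
  | zero => simp [sizeSum]
  | succ k ih =>
    have h : sizeSum k ≤ modulus k := le_trans (Nat.le_mul_of_pos_left _ (by omega)) ih
    rw [sizeSum, Finset.sum_range_succ, ← sizeSum, modulus]
    calc (k + 1 + 1) * (sizeSum k + modulus k * dirNorm k)
        ≤ (k + 1 + 1) * (modulus k + modulus k * dirNorm k) := by gcongr
      _ = _ := by ring

lemma two_mul_sizeSum_le (k : ℕ) : 2 * sizeSum k ≤ modulus k := by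
  rcases k with _ | k
  · simp [sizeSum]
  · refine le_trans ?_ (succ_mul_sizeSum_le (k + 1))
    gcongr
    omega

/-- The partial sums of the series `∑ cᵢ * modulus i * wᵢ`, for binary digits `cᵢ`. -/
def digitSum (w : ℕ → ℤ) (c : ℕ → Fin 2) (k : ℕ) : ℤ :=
  ∑ i ∈ Finset.range k, ((c i : ℕ) : ℤ) * (modulus i * w i)

lemma digitSum_zero (w : ℕ → ℤ) (c : ℕ → Fin 2) : digitSum w c 0 = 0 := rfl

lemma digitSum_succ (w : ℕ → ℤ) (c : ℕ → Fin 2) (k : ℕ) :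
    digitSum w c (k + 1) = digitSum w c k + ((c k : ℕ) : ℤ) * (modulus k * w k) :=
  Finset.sum_range_succ _ _

lemma digitSum_congr (w : ℕ → ℤ) {c c' : ℕ → Fin 2} {k : ℕ} (h : ∀ i < k, c i = c' i) :
    digitSum w c k = digitSum w c' k :=
  Finset.sum_congr rfl fun i hi => by rw [h i (Finset.mem_range.mp hi)]

lemma abs_digitSum_sub_le {w : ℕ → ℤ} (hw : ∀ i, (w i).natAbs ≤ dirNorm i) (c c' : ℕ → Fin 2)
    (k : ℕ) : |digitSum w c' k - digitSum w c k| ≤ sizeSum k := by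
  rw [digitSum, digitSum, ← Finset.sum_sub_distrib, sizeSum]
  refine (Finset.abs_sum_le_sum_abs _ _).trans ?_
  push_cast
  refine Finset.sum_le_sum fun i _ => ?_
  have h1 : |(((c' i : ℕ) : ℤ) - ((c i : ℕ) : ℤ))| ≤ 1 := by
    have := (c' i).isLt
    have := (c i).isLt
    rw [abs_le]
    constructor <;> omega
  have h2 : |w i| ≤ dirNorm i := by
    rw [Int.abs_eq_natAbs]
    exact_mod_cast hw i
  rw [← sub_mul, abs_mul, abs_mul, Nat.abs_cast]
  calc _ ≤ 1 * ((modulus i : ℤ) * dirNorm i) := by gcongr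
    _ = _ := one_mul _

lemma fst_natAbs_le (i : ℕ) : (dirSeq i).1.natAbs ≤ dirNorm i := Nat.le_add_right _ _

lemma snd_natAbs_le (i : ℕ) : (dirSeq i).2.natAbs ≤ dirNorm i := Nat.le_add_left _ _

/-- A congruence between digit sums is an equality once the modulus is large enough. -/
lemma eq_digitSum_sub {w : ℕ → ℤ} (hw : ∀ i, (w i).natAbs ≤ dirNorm i) {c c' : ℕ → Fin 2}
    {k : ℕ} {n : ℤ} (hn : |n| + sizeSum k < modulus k)
    (h : (n : ZMod (modulus k)) + digitSum w c k = digitSum w c' k) :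
    n = digitSum w c' k - digitSum w c k := by
  have h1 : ((n - (digitSum w c' k - digitSum w c k) : ℤ) : ZMod (modulus k)) = 0 := by
    push_cast
    rw [← h]
    ring
  rw [ZMod.intCast_zmod_eq_zero_iff_dvd] at h1
  have h2 := Int.eq_zero_of_abs_lt_dvd h1
    (((abs_sub _ _).trans (by gcongr; exact abs_digitSum_sub_le hw c c' k)).trans_lt hn)
  linarith

/-- The compact ring `∏ ℤ/(modulus k)`. -/
abbrev ModRing : Type := ∀ k, ZMod (modulus k)

/-- Left translation of the Heisenberg group over `ModRing` by an integer point. -/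
def heisAct (a : ℤ × ℤ × ℤ) (x : ModRing × ModRing × ModRing) : ModRing × ModRing × ModRing :=
  ((a.1 : ModRing) + x.1, (a.2.1 : ModRing) + x.2.1,
    (a.2.2 : ModRing) + x.2.2 + (a.1 : ModRing) * x.2.1)

/-- The inverse in `H₃(ℤ)`. -/
def hInv (a : ℤ × ℤ × ℤ) : ℤ × ℤ × ℤ := (-a.1, -a.2.1, -a.2.2 + a.1 * a.2.1)

lemma heisAct_hMul (a b : ℤ × ℤ × ℤ) (x : ModRing × ModRing × ModRing) :
    heisAct (hMul a b) x = heisAct a (heisAct b x) := by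
  simp only [heisAct, hMul, Prod.mk.injEq]
  push_cast
  refine ⟨?_, ?_, ?_⟩ <;> ring

lemma heisAct_zero (x : ModRing × ModRing × ModRing) : heisAct 0 x = x := by
  simp [heisAct]

lemma hMul_hInv (a : ℤ × ℤ × ℤ) : hMul a (hInv a) = 0 := by
  simp [hMul, hInv, Prod.ext_iff]

lemma hInv_hMul (a : ℤ × ℤ × ℤ) : hMul (hInv a) a = 0 := by
  simp [hMul, hInv, Prod.ext_iff]

lemma measurable_heisAct (a : ℤ × ℤ × ℤ) : Measurable (heisAct a) := by
  have h1 (n : ℤ) (f : ModRing × ModRing × ModRing → ModRing) (hf : Measurable f) :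
      Measurable fun x => (n : ModRing) + f x :=
    measurable_pi_iff.mpr fun k =>
      (Measurable.of_discrete (f := fun y : ZMod (modulus k) => (n : ZMod (modulus k)) + y)).comp
        ((measurable_pi_apply k).comp hf)
  refine (h1 _ _ measurable_fst).prodMk ((h1 _ _ measurable_snd.fst).prodMk ?_)
  refine measurable_pi_iff.mpr fun k => ?_
  have h2 : Measurable fun x : ModRing × ModRing × ModRing => (x.2.2 k, x.2.1 k) :=
    ((measurable_pi_apply k).comp measurable_snd.snd).prodMk
      ((measurable_pi_apply k).comp measurable_snd.fst)
  exact (Measurable.of_discrete (f := fun y : ZMod (modulus k) × ZMod (modulus k) =>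
    (a.2.2 : ZMod (modulus k)) + y.1 + (a.1 : ZMod (modulus k)) * y.2)).comp h2

/-- The action of `H₃(ℤ)` by left translations. -/
def heisEquiv (a : ℤ × ℤ × ℤ) :
    (ModRing × ModRing × ModRing) ≃ᵐ (ModRing × ModRing × ModRing) where
  toFun := heisAct a
  invFun := heisAct (hInv a)
  left_inv x := by rw [← heisAct_hMul, hInv_hMul, heisAct_zero]
  right_inv x := by rw [← heisAct_hMul, hMul_hInv, heisAct_zero]
  measurable_toFun := measurable_heisAct a
  measurable_invFun := measurable_heisAct (hInv a)

lemma heisEquiv_apply (a : ℤ × ℤ × ℤ) (x : ModRing × ModRing × ModRing) :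
    heisEquiv a x = heisAct a x := rfl

lemma mem_image_heisEquiv {a : ℤ × ℤ × ℤ} {A : Set (ModRing × ModRing × ModRing)}
    {x : ModRing × ModRing × ModRing} : x ∈ heisEquiv a '' A ↔ heisAct (hInv a) x ∈ A :=
  Set.mem_image_equiv (f := (heisEquiv a).toEquiv)

lemma intCast_modRing_injective : Function.Injective (Int.cast : ℤ → ModRing) := by
  refine (injective_iff_map_eq_zero (Int.castRingHom ModRing)).mpr fun n hn => ?_
  have h := congrFun hn n.natAbs
  rw [eq_intCast, Pi.intCast_apply, Pi.zero_apply, ZMod.intCast_zmod_eq_zero_iff_dvd] at h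
  refine Int.eq_zero_of_abs_lt_dvd h ?_
  have := succ_le_modulus n.natAbs
  rw [Int.abs_eq_natAbs]
  omega

lemma heisAct_ne {a : ℤ × ℤ × ℤ} (ha : a ≠ 0) (x : ModRing × ModRing × ModRing) :
    heisAct a x ≠ x := by
  intro h
  simp only [heisAct, Prod.ext_iff, add_eq_right] at h
  obtain ⟨h1, h2, h3⟩ := h
  rw [h1, zero_mul, add_zero, add_eq_right] at h3
  rw [← Int.cast_zero (R := ModRing)] at h1 h2 h3
  exact ha (Prod.ext (intCast_modRing_injective h1)
    (Prod.ext (intCast_modRing_injective h2) (intCast_modRing_injective h3)))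

/-- The binary expansion map from the Cantor group to the Heisenberg group over `ModRing`. -/
def cantorMap (c : ℕ → Fin 2) : ModRing × ModRing × ModRing :=
  (fun k => digitSum (fun i => (dirSeq i).1) c k, 0, fun k => digitSum (fun i => (dirSeq i).2) c k)

lemma measurable_cantorMap : Measurable cantorMap := by
  have h (w : ℕ → ℤ) : Measurable fun (c : ℕ → Fin 2) (k : ℕ) =>
      (digitSum w c k : ZMod (modulus k)) := by
    refine measurable_pi_iff.mpr fun k => (Measurable.of_discrete (f := Int.cast)).comp ?_
    refine Finset.measurable_sum _ fun i _ => ?_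
    exact (Measurable.of_discrete (f := fun y : Fin 2 => ((y : ℕ) : ℤ) * (modulus i * w i))).comp
      (measurable_pi_apply i)
  exact (h _).prodMk (measurable_const.prodMk (h _))

lemma of_heisAct_cantorMap_eq {a : ℤ × ℤ × ℤ} {c c' : ℕ → Fin 2}
    (h : heisAct a (cantorMap c) = cantorMap c') :
    a.2.1 = 0 ∧ ∀ k, |a.1| + sizeSum k < modulus k → |a.2.2| + sizeSum k < modulus k →
      a.1 = digitSum (fun i => (dirSeq i).1) c' k - digitSum (fun i => (dirSeq i).1) c k ∧
      a.2.2 = digitSum (fun i => (dirSeq i).2) c' k - digitSum (fun i => (dirSeq i).2) c k := by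
  simp only [heisAct, cantorMap, Prod.mk.injEq, mul_zero, add_zero] at h
  obtain ⟨h1, h2, h3⟩ := h
  refine ⟨intCast_modRing_injective (h2.trans Int.cast_zero.symm), fun k hk hk' => ⟨?_, ?_⟩⟩
  · exact eq_digitSum_sub fst_natAbs_le hk (congrFun h1 k)
  · exact eq_digitSum_sub snd_natAbs_le hk' (congrFun h3 k)

lemma eq_of_digitSum_sub_eq {c c' : ℕ → Fin 2} {k : ℕ}
    (h1 : digitSum (fun i => (dirSeq i).1) c' k - digitSum (fun i => (dirSeq i).1) c k =
      digitSum (fun i => (dirSeq i).1) c' (k + 1) - digitSum (fun i => (dirSeq i).1) c (k + 1))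
    (h2 : digitSum (fun i => (dirSeq i).2) c' k - digitSum (fun i => (dirSeq i).2) c k =
      digitSum (fun i => (dirSeq i).2) c' (k + 1) - digitSum (fun i => (dirSeq i).2) c (k + 1)) :
    c k = c' k := by
  have h0 : (modulus k : ℤ) ≠ 0 := mod_cast NeZero.ne (modulus k)
  have key (w : ℤ) (hw : w ≠ 0)
      (h : ((c' k : ℕ) : ℤ) * (modulus k * w) = ((c k : ℕ) : ℤ) * (modulus k * w)) :
      c k = c' k := by
    have := mul_right_cancel₀ (mul_ne_zero h0 hw) h
    exact Fin.ext (by exact_mod_cast this.symm)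
  simp only [digitSum_succ] at h1 h2
  rcases dirSeq_ne_zero k with h | h
  · exact key _ h (by linarith)
  · exact key _ h (by linarith)

lemma cantorMap_injective : Function.Injective cantorMap := by
  intro c c' h
  have h' := (of_heisAct_cantorMap_eq (a := 0) (c := c) (c' := c') (by rw [heisAct_zero, h])).2
  have hk (k : ℕ) := h' k
    (by have := two_mul_sizeSum_le k; have := succ_le_modulus k; simp; omega)
    (by have := two_mul_sizeSum_le k; have := succ_le_modulus k; simp; omega)
  funext k
  exact eq_of_digitSum_sub_eq ((hk k).1.symm.trans (hk (k + 1)).1)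
    ((hk k).2.symm.trans (hk (k + 1)).2)

lemma exists_forall_eq_digitSum_sub {a : ℤ × ℤ × ℤ} {c c' : ℕ → Fin 2}
    (h : heisAct a (cantorMap c) = cantorMap c') :
    ∃ N, ∀ k, N ≤ k →
      a.1 = digitSum (fun i => (dirSeq i).1) c' k - digitSum (fun i => (dirSeq i).1) c k ∧
      a.2.2 = digitSum (fun i => (dirSeq i).2) c' k - digitSum (fun i => (dirSeq i).2) c k := by
  refine ⟨2 * (a.1.natAbs + a.2.2.natAbs), fun k hk => (of_heisAct_cantorMap_eq h).2 k ?_ ?_⟩ <;>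
  · have := two_mul_sizeSum_le k
    have := succ_le_modulus k
    rw [Int.abs_eq_natAbs]
    omega

/-- Points of the Cantor set in the same orbit differ by a finitely supported digit sequence. -/
lemma exists_finsupp_of_heisAct_eq {a : ℤ × ℤ × ℤ} {c c' : ℕ → Fin 2}
    (h : heisAct a (cantorMap c) = cantorMap c') : ∃ f : ℕ →₀ Fin 2, c' = c + ⇑f := by
  obtain ⟨N, hN⟩ := exists_forall_eq_digitSum_sub h
  refine ⟨Finsupp.onFinset (Finset.range N) (c' - c) fun i hi => ?_, by simp⟩
  by_contra hiN
  rw [Finset.mem_range, not_lt] at hiN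
  refine hi (sub_eq_zero.mpr (eq_of_digitSum_sub_eq ?_ ?_).symm)
  · exact (hN i hiN).1.symm.trans (hN (i + 1) (by omega)).1
  · exact (hN i hiN).2.symm.trans (hN (i + 1) (by omega)).2

/-- The integer translation corresponding to raising the `k`-th digit. -/
lemma heisAct_cantorMap_add_single {c : ℕ → Fin 2} {k : ℕ} (hc : c k = 0) :
    heisAct (modulus k * (dirSeq k).1, 0, modulus k * (dirSeq k).2) (cantorMap c) =
      cantorMap (c + Pi.single k 1) := by
  have key (w : ℕ → ℤ) (j : ℕ) :
      ((modulus k : ℤ) * w k : ZMod (modulus j)) + digitSum w c j =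
        digitSum w (c + Pi.single k 1) j := by
    rcases le_or_gt j k with hj | hj
    · have h0 : ((modulus k : ℕ) : ZMod (modulus j)) = 0 :=
        (ZMod.natCast_eq_zero_iff _ _).mpr (modulus_dvd hj)
      have h1 : digitSum w (c + Pi.single k 1) j = digitSum w c j :=
        digitSum_congr w fun i hi => by simp [Pi.single_eq_of_ne (show i ≠ k by omega)]
      rw [h1]
      push_cast
      rw [h0]
      ring
    · rw [← Int.cast_mul, ← Int.cast_add]
      congr 1
      induction j, (show k + 1 ≤ j from hj) using Nat.le_induction with
      | base =>
        have h1 : digitSum w (c + Pi.single k 1) k = digitSum w c k :=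
          digitSum_congr w fun i hi => by simp [Pi.single_eq_of_ne (show i ≠ k by omega)]
        rw [digitSum_succ, digitSum_succ, h1, Pi.add_apply, hc, Pi.single_eq_same]
        simp
        ring
      | succ j hj' ih =>
        rw [digitSum_succ, digitSum_succ, ← ih (by omega), Pi.add_apply,
          Pi.single_eq_of_ne (show j ≠ k by omega)]
        simp
        ring
  simp only [heisAct, cantorMap, Prod.mk.injEq, mul_zero, add_zero]
  refine ⟨funext fun j => ?_, by simp, funext fun j => ?_⟩
  · simpa using key (fun i => (dirSeq i).1) j
  · simpa using key (fun i => (dirSeq i).2) j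

/-- Haar measure on the Cantor group. -/
abbrev cantorHaar : Measure (ℕ → Fin 2) := Measure.addHaar

/-- The image of Haar measure on the translate of the Cantor set by `a`. -/
def translateMeasure (a : ℤ × ℤ × ℤ) : Measure (ModRing × ModRing × ModRing) :=
  cantorHaar.map fun c => heisAct a (cantorMap c)

lemma measurable_translate (a : ℤ × ℤ × ℤ) : Measurable fun c => heisAct a (cantorMap c) :=
  (measurable_heisAct a).comp measurable_cantorMap

/-- The least measure dominating all the measures `translateMeasure a`. -/
def heisMeasure : Measure (ModRing × ModRing × ModRing) := ⨆ a, translateMeasure a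

lemma map_heisEquiv_translateMeasure (a b : ℤ × ℤ × ℤ) :
    (translateMeasure b).map (heisEquiv a) = translateMeasure (hMul a b) := by
  rw [translateMeasure, Measure.map_map (heisEquiv a).measurable (measurable_translate b)]
  congr 1
  funext c
  exact (heisAct_hMul a b _).symm

lemma hMul_hInv_cancel_left (a b : ℤ × ℤ × ℤ) : hMul a (hMul (hInv a) b) = b := by
  simp only [hMul, hInv, Prod.ext_iff]
  refine ⟨?_, ?_, ?_⟩ <;> ring

lemma heisMeasure_le_map (a : ℤ × ℤ × ℤ) : heisMeasure ≤ heisMeasure.map (heisEquiv a) := by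
  refine iSup_le fun b => ?_
  rw [← hMul_hInv_cancel_left a b, ← map_heisEquiv_translateMeasure]
  exact Measure.map_mono (le_iSup translateMeasure _) (heisEquiv a).measurable

lemma measurePreserving_heisEquiv (a : ℤ × ℤ × ℤ) :
    MeasurePreserving (heisEquiv a) heisMeasure heisMeasure := by
  refine ⟨(heisEquiv a).measurable, le_antisymm ?_ (heisMeasure_le_map a)⟩
  have h := Measure.map_mono (heisMeasure_le_map (hInv a)) (heisEquiv a).measurable
  rw [Measure.map_map (heisEquiv a).measurable (heisEquiv _).measurable] at h
  have h1 : heisEquiv a ∘ heisEquiv (hInv a) = id := by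
    funext x
    exact (heisEquiv a).right_inv x
  rwa [h1, Measure.map_id] at h

/-- The Cantor set carrying `translateMeasure 0`. -/
def cantorImage : Set (ModRing × ModRing × ModRing) := Set.range cantorMap

lemma measurableEmbedding_cantorMap : MeasurableEmbedding cantorMap :=
  measurable_cantorMap.measurableEmbedding cantorMap_injective

lemma measurableSet_cantorImage : MeasurableSet cantorImage :=
  measurableEmbedding_cantorMap.measurableSet_range

/-- The measures `translateMeasure a` are compatible with each other. -/
lemma restrict_translateMeasure_le (a : ℤ × ℤ × ℤ) :
    (translateMeasure a).restrict cantorImage ≤ translateMeasure 0 := by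
  refine Measure.le_iff.mpr fun B hB => ?_
  rw [Measure.restrict_apply hB, translateMeasure, translateMeasure,
    Measure.map_apply (measurable_translate a) (hB.inter measurableSet_cantorImage),
    Measure.map_apply (measurable_translate 0) hB]
  set E : (ℕ →₀ Fin 2) → Set (ℕ → Fin 2) := fun f =>
    {c | heisAct a (cantorMap c) ∈ B ∧ heisAct a (cantorMap c) = cantorMap (c + ⇑f)} with hE
  have hEm (f) : MeasurableSet (E f) :=
    (measurable_translate a hB).inter (measurableSet_eq_fun (measurable_translate a)
      (measurable_cantorMap.comp (measurable_id.add_const _)))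
  have hcover : (fun c => heisAct a (cantorMap c)) ⁻¹' (B ∩ cantorImage) ⊆ ⋃ f, E f := by
    rintro c ⟨hcB, c', hc'⟩
    obtain ⟨f, rfl⟩ := exists_finsupp_of_heisAct_eq hc'.symm
    exact Set.mem_iUnion.mpr ⟨f, hcB, hc'.symm⟩
  set F : (ℕ →₀ Fin 2) → Set (ℕ → Fin 2) := fun f => (fun c => c + -⇑f) ⁻¹' E f with hF
  have hFm (f) : MeasurableSet (F f) := (measurable_id.add_const _) (hEm f)
  have hEF (f) : cantorHaar (E f) = cantorHaar (F f) :=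
    (measure_preimage_add_right cantorHaar _ _).symm
  have hFeq {f c} (h : c ∈ F f) :
      heisAct a (cantorMap (c + -⇑f)) ∈ B ∧ heisAct a (cantorMap (c + -⇑f)) = cantorMap c := by
    simpa [hF, hE] using h
  have hdisj : Pairwise (Function.onFun Disjoint F) := by
    intro f f' hff
    refine Set.disjoint_left.mpr fun c hc hc' => hff ?_
    have h := (heisEquiv a).injective ((hFeq hc).2.trans (hFeq hc').2.symm)
    exact DFunLike.coe_injective (neg_injective (add_left_cancel (cantorMap_injective h)))
  have hsub : ⋃ f, F f ⊆ (fun c => heisAct 0 (cantorMap c)) ⁻¹' B := by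
    refine Set.iUnion_subset fun f c hc => ?_
    rw [Set.mem_preimage, heisAct_zero, ← (hFeq hc).2]
    exact (hFeq hc).1
  calc _ ≤ cantorHaar (⋃ f, E f) := measure_mono hcover
    _ ≤ ∑' f, cantorHaar (E f) := measure_iUnion_le _
    _ = ∑' f, cantorHaar (F f) := by simp_rw [hEF]
    _ = cantorHaar (⋃ f, F f) := (measure_iUnion hdisj hFm).symm
    _ ≤ _ := measure_mono hsub

lemma heisMeasure_cantorImage_lt_top : heisMeasure cantorImage < ⊤ := by
  have h : heisMeasure ≤
      translateMeasure 0 + (Measure.sum translateMeasure).restrict cantorImageᶜ := by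
    refine iSup_le fun a => ?_
    rw [← Measure.restrict_add_restrict_compl (μ := translateMeasure a) measurableSet_cantorImage]
    exact add_le_add (restrict_translateMeasure_le a)
      (Measure.restrict_mono le_rfl (Measure.le_sum _ _))
  refine (h cantorImage).trans_lt ?_
  rw [Measure.add_apply, Measure.restrict_apply measurableSet_cantorImage, Set.inter_compl_self,
    measure_empty, add_zero, translateMeasure,
    Measure.map_apply (measurable_translate 0) measurableSet_cantorImage]
  exact measure_lt_top _ _

lemma heisMeasure_image_heisEquiv (a : ℤ × ℤ × ℤ) (A : Set (ModRing × ModRing × ModRing)) :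
    heisMeasure (heisEquiv a '' A) = heisMeasure A := by
  rw [← (measurePreserving_heisEquiv a).measure_preimage_equiv, Set.preimage_image_eq]
  exact (heisEquiv a).injective

lemma heisMeasure_le_sum : heisMeasure ≤ Measure.sum translateMeasure :=
  iSup_le fun a => Measure.le_sum _ a

instance : SigmaFinite heisMeasure := by
  refine Measure.sigmaFinite_of_countable
    (S := insert (⋃ a, heisEquiv a '' cantorImage)ᶜ (Set.range fun a => heisEquiv a '' cantorImage))
    ((Set.countable_range _).insert _) ?_ ?_
  · rintro s (rfl | ⟨a, rfl⟩)
    · have hm : MeasurableSet (⋃ a, heisEquiv a '' cantorImage)ᶜ :=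
        (MeasurableSet.iUnion fun a =>
          (heisEquiv a).measurableSet_image.mpr measurableSet_cantorImage).compl
      refine (heisMeasure_le_sum _).trans_lt ?_
      rw [Measure.sum_apply _ hm, ENNReal.tsum_eq_zero.mpr fun a => ?_]
      · exact ENNReal.zero_lt_top
      rw [translateMeasure, Measure.map_apply (measurable_translate a) hm]
      convert measure_empty (μ := cantorHaar)
      refine Set.eq_empty_of_forall_notMem fun c hc => hc ?_
      exact Set.mem_iUnion.mpr ⟨a, cantorMap c, Set.mem_range_self c, rfl⟩
    · rw [heisMeasure_image_heisEquiv]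
      exact heisMeasure_cantorImage_lt_top
  · rw [Set.sUnion_insert, Set.sUnion_range]
    exact Set.compl_union_self _

lemma translateMeasure_le (a : ℤ × ℤ × ℤ) : translateMeasure a ≤ heisMeasure :=
  le_iSup translateMeasure a

lemma heisMeasure_image_cantorMap_pos {E : Set (ℕ → Fin 2)} (hE : MeasurableSet E)
    (hpos : 0 < cantorHaar E) : 0 < heisMeasure (cantorMap '' E) := by
  refine lt_of_lt_of_le hpos (le_trans ?_ (translateMeasure_le 0 _))
  rw [translateMeasure, Measure.map_apply (measurable_translate 0)
    (measurableEmbedding_cantorMap.measurableSet_image.mpr hE)]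
  refine measure_mono fun c hc => ?_
  rw [Set.mem_preimage, heisAct_zero]
  exact Set.mem_image_of_mem _ hc

lemma heisMeasure_univ : heisMeasure Set.univ = ⊤ := by
  have hm (b : ℤ) : MeasurableSet (heisEquiv (0, b, 0) '' cantorImage) :=
    (heisEquiv _).measurableSet_image.mpr measurableSet_cantorImage
  have hd : Pairwise (Function.onFun Disjoint fun b : ℤ => heisEquiv (0, b, 0) '' cantorImage) := by
    intro b b' hb
    refine Set.disjoint_left.mpr ?_
    rintro _ ⟨_, ⟨c, rfl⟩, rfl⟩ ⟨_, ⟨c', rfl⟩, h⟩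
    have h1 := congrArg (fun x => x.2.1) h
    simp only [heisEquiv_apply, heisAct, cantorMap, add_zero] at h1
    exact hb (intCast_modRing_injective h1).symm
  have hpos : heisMeasure cantorImage ≠ 0 := by
    rw [cantorImage, ← Set.image_univ]
    exact (heisMeasure_image_cantorMap_pos MeasurableSet.univ
      (isOpen_univ.measure_pos _ Set.univ_nonempty)).ne'
  refine top_le_iff.mp (le_trans (le_of_eq ?_)
    (measure_mono (Set.subset_univ (⋃ b : ℤ, heisEquiv (0, b, 0) '' cantorImage))))
  rw [measure_iUnion hd hm]
  simp_rw [heisMeasure_image_heisEquiv]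
  exact (ENNReal.tsum_const_eq_top_of_ne_zero hpos).symm

/-- Raising or lowering arbitrarily late digits returns to any set of positive measure. -/
lemma exists_measure_inter_add_single_pos {E : Set (ℕ → Fin 2)} (hE : MeasurableSet E)
    (hpos : 0 < cantorHaar E) (o : Option ℤ) :
    ∃ k, dirSeq k = slopeVec o ∧ 0 < cantorHaar {c | c ∈ E ∧ c + Pi.single k 1 ∈ E} := by
  by_contra! hcon
  set N : ℕ → Set (ℕ → Fin 2) := fun k =>
    {c | dirSeq k = slopeVec o ∧ c ∈ E ∧ c + Pi.single k 1 ∈ E} with hN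
  have hN0 : cantorHaar (⋃ k, N k) = 0 := by
    refine measure_iUnion_null fun k => ?_
    by_cases hk : dirSeq k = slopeVec o
    · simpa [hN, hk] using hcon k hk
    · simp [hN, hk]
  have hNm : MeasurableSet (⋃ k, N k) := by
    refine MeasurableSet.iUnion fun k => ?_
    exact (MeasurableSet.const _).inter (hE.inter ((measurable_id.add_const _) hE))
  have hpos' : 0 < cantorHaar (E \ ⋃ k, N k) := by
    rwa [measure_sdiff_null hN0]
  have hnhds := Measure.sub_mem_nhds_zero_of_addHaar_pos cantorHaar _ (hE.diff hNm) hpos'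
  have hlim : Tendsto (fun k : ℕ => (Pi.single k 1 : ℕ → Fin 2)) atTop (𝓝 0) := by
    refine tendsto_pi_nhds.mpr fun i => tendsto_const_nhds.congr' ?_
    filter_upwards [eventually_gt_atTop i] with k hk
    rw [Pi.single_eq_of_ne hk.ne, Pi.zero_apply]
  obtain ⟨K, hK⟩ := eventually_atTop.mp (hlim.eventually hnhds)
  obtain ⟨k, hkK, hk⟩ := exists_dirSeq_eq o K
  obtain ⟨c', hc', c, hc, h⟩ := Set.mem_sub.mp (hK k hkK)
  refine hc.2 (Set.mem_iUnion.mpr ⟨k, hk, hc.1, ?_⟩)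
  rw [← h, add_sub_cancel]
  exact hc'.1

/-- The action returns along multiples of `slopeVec o`. -/
lemma exists_return {A : Set (ModRing × ModRing × ModRing)} (hA : MeasurableSet A)
    (hpos : 0 < heisMeasure A) (o : Option ℤ) :
    ∃ n : ℤ, n ≠ 0 ∧ 0 < heisMeasure
      (A ∩ heisEquiv (n * (slopeVec o).1, 0, n * (slopeVec o).2) '' A) := by
  obtain ⟨g, hg⟩ : ∃ g, 0 < translateMeasure g A := by
    by_contra! hcon
    refine hpos.ne' (le_antisymm ((heisMeasure_le_sum A).trans ?_) zero_le)
    rw [Measure.sum_apply _ hA, ENNReal.tsum_eq_zero.mpr fun a => le_antisymm (hcon a) zero_le]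
  rw [translateMeasure, Measure.map_apply (measurable_translate g) hA] at hg
  obtain ⟨o', ho'⟩ : ∃ o', slopeVec o' =
      ((slopeVec o).1, (slopeVec o).2 + (slopeVec o).1 * g.2.1) := by
    rcases o with _ | l
    · exact ⟨none, by simp [slopeVec]⟩
    · exact ⟨some (l + g.2.1), by simp [slopeVec]⟩
  set f : (ℕ → Fin 2) → ModRing × ModRing × ModRing := fun c => heisAct g (cantorMap c) with hf
  obtain ⟨k, hk, hW⟩ := exists_measure_inter_add_single_pos (measurable_translate g hA) hg o'
  set a : ℤ → ℤ × ℤ × ℤ := fun n => (n * (slopeVec o).1, 0, n * (slopeVec o).2) with ha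
  have hshift {c : ℕ → Fin 2} (hc : c k = 0) :
      heisAct (a (modulus k)) (f c) = f (c + Pi.single k 1) := by
    simp only [hf]
    rw [← heisAct_cantorMap_add_single hc, ← heisAct_hMul, ← heisAct_hMul, hk, ho']
    congr 1
    simp only [hMul, ha, Prod.mk.injEq]
    refine ⟨?_, ?_, ?_⟩ <;> ring
  have hmk : (modulus k : ℤ) ≠ 0 := mod_cast NeZero.ne (modulus k)
  have hle (B : Set (ModRing × ModRing × ModRing)) (V : Set (ℕ → Fin 2)) (hV : 0 < cantorHaar V)
      (hVB : ∀ c ∈ V, f c ∈ B) : 0 < heisMeasure B :=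
    hV.trans_le <| (measure_mono hVB).trans <|
      (Measure.le_map_apply (measurable_translate g).aemeasurable B).trans (translateMeasure_le g B)
  set W : Set (ℕ → Fin 2) := {c | f c ∈ A ∧ f (c + Pi.single k 1) ∈ A} with hWdef
  have hsplit : 0 < cantorHaar (W ∩ {c | c k = 0}) ∨ 0 < cantorHaar (W ∩ {c | c k = 1}) := by
    by_contra! hcon
    refine hW.ne' (measure_mono_null (t := W ∩ {c | c k = 0} ∪ W ∩ {c | c k = 1}) ?_
      (measure_union_null (le_antisymm hcon.1 zero_le) (le_antisymm hcon.2 zero_le)))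
    intro c hc
    rcases (show ∀ y : Fin 2, y = 0 ∨ y = 1 by decide) (c k) with h | h
    · exact Or.inl ⟨hc, h⟩
    · exact Or.inr ⟨hc, h⟩
  rcases hsplit with hV | hV
  · refine ⟨-modulus k, neg_ne_zero.mpr hmk, hle _ _ hV ?_⟩
    rintro c ⟨⟨hc, hc'⟩, hck⟩
    refine ⟨hc, mem_image_heisEquiv.mpr ?_⟩
    have : hInv (a (-modulus k)) = a (modulus k) := by simp [hInv, ha]
    rwa [this, hshift hck]
  · refine ⟨modulus k, hmk, hle _ _ hV ?_⟩
    rintro c ⟨⟨hc, hc'⟩, hck⟩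
    refine ⟨hc, f (c + Pi.single k 1), hc', ?_⟩
    have h0 : (c + Pi.single k 1 : ℕ → Fin 2) k = 0 := by
      rw [Pi.add_apply, Pi.single_eq_same, show c k = 1 from hck]
      decide
    have h2 : c + Pi.single k 1 + Pi.single k 1 = c := by
      rw [add_assoc, ← Pi.single_add, show (1 + 1 : Fin 2) = 0 by decide, Pi.single_zero, add_zero]
    exact (hshift h0).trans (by rw [h2])

lemma mem_expLine_mk {v : ℝ × ℝ × ℝ} (hv : v ≠ 0) {g : ℝ × ℝ × ℝ} :
    g ∈ expLine (Projectivization.mk ℝ v hv) ↔ ∃ s : ℝ, hExp (s • v) = g := by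
  simp [expLine, Projectivization.submodule_mk, Submodule.mem_span_singleton]

lemma recurrentAlong_of_slopeVec (o : Option ℤ)
    (hv : (((slopeVec o).1 : ℝ), (0 : ℝ), ((slopeVec o).2 : ℝ)) ≠ 0) :
    H3RecurrentAlong heisMeasure heisEquiv (Projectivization.mk ℝ _ hv) := by
  intro ε hε A hA hpos
  obtain ⟨n, hn, h⟩ := exists_return hA hpos o
  refine ⟨_, ?_, _, (mem_expLine_mk hv).mpr ⟨n, rfl⟩, ?_, h⟩
  · rcases o with _ | l <;> simp [slopeVec, Prod.ext_iff, hn]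
  · simpa [hDist, hCast, hExp] using hε

lemma recurrentAlong_thetaLine (l : ℤ) :
    H3RecurrentAlong heisMeasure heisEquiv (thetaLine l) := by
  have h := recurrentAlong_of_slopeVec (some l) (by simp [slopeVec, Prod.ext_iff])
  simp only [slopeVec, Int.cast_one] at h
  exact h

lemma recurrentAlong_thetaInf : H3RecurrentAlong heisMeasure heisEquiv thetaInf := by
  have h := recurrentAlong_of_slopeVec none (by simp [slopeVec, Prod.ext_iff])
  simp only [slopeVec, Int.cast_zero, Int.cast_one] at h
  exact h

lemma exists_of_measure_inter_image_pos {a : ℤ × ℤ × ℤ} {E : Set (ℕ → Fin 2)}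
    (h : 0 < heisMeasure (cantorMap '' E ∩ heisEquiv a '' (cantorMap '' E))) :
    ∃ c ∈ E, ∃ c' ∈ E, heisAct a (cantorMap c) = cantorMap c' := by
  obtain ⟨_, ⟨c', hc', rfl⟩, _, ⟨c, hc, rfl⟩, hx⟩ := nonempty_of_measure_ne_zero h.ne'
  exact ⟨c, hc, c', hc', hx⟩

lemma not_recurrentAlong_of_snd_ne_zero {α β γ : ℝ} (hβ : β ≠ 0)
    (hv : ((α, β, γ) : ℝ × ℝ × ℝ) ≠ 0) :
    ¬ H3RecurrentAlong heisMeasure heisEquiv (Projectivization.mk ℝ (α, β, γ) hv) := by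
  intro hrec
  set K : ℝ := (|α| + |γ|) / |β| + 1 with hK
  have hβ' : 0 < |β| := abs_pos.mpr hβ
  have hK1 : 1 ≤ K := le_add_of_nonneg_left (by positivity)
  have hα : |α| ≤ K * |β| := by
    rw [hK, add_mul, div_mul_cancel₀ _ hβ'.ne']
    linarith [abs_nonneg γ]
  have hγ : |γ| ≤ K * |β| := by
    rw [hK, add_mul, div_mul_cancel₀ _ hβ'.ne']
    linarith [abs_nonneg α]
  obtain ⟨a, ha, g, hg, hd, hpos⟩ := hrec (1 / (8 * K)) (by positivity) (cantorMap '' Set.univ)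
    (measurableEmbedding_cantorMap.measurableSet_image.mpr MeasurableSet.univ)
    (heisMeasure_image_cantorMap_pos MeasurableSet.univ
      (isOpen_univ.measure_pos _ Set.univ_nonempty))
  obtain ⟨s, rfl⟩ := (mem_expLine_mk hv).mp hg
  obtain ⟨c, -, c', -, hcc⟩ := exists_of_measure_inter_image_pos hpos
  have ha2 := (of_heisAct_cantorMap_eq hcc).1
  obtain ⟨n, b, m⟩ := a
  obtain rfl : b = 0 := ha2
  simp only [hDist, hCast, hExp, Prod.smul_mk, smul_eq_mul, Int.cast_zero, zero_sub, abs_neg] at hd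
  set ε : ℝ := 1 / (8 * K) with hε
  have hε0 : 0 < ε := by positivity
  have hεK : ε * K = 1 / 8 := by rw [hε]; field_simp
  have hε1 : ε ≤ 1 / 8 := by nlinarith
  have h1 := abs_nonneg ((n : ℝ) - s * α)
  have h2 := abs_nonneg (s * β)
  have h3 := abs_nonneg ((m : ℝ) - (s * γ + s * α * (s * β) / 2) + s * β * (s * α - n))
  have hsβ : |s * β| ≤ ε := by linarith
  have hbound {y : ℝ} (hy : |y| ≤ K * |β|) : |s * y| ≤ 1 / 8 := by
    rw [abs_mul] at hsβ ⊢
    calc |s| * |y| ≤ |s| * (K * |β|) := by gcongr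
      _ = (|s| * |β|) * K := by ring
      _ ≤ ε * K := by gcongr
      _ = 1 / 8 := hεK
  have hsα := hbound hα
  have hsγ := hbound hγ
  have hn : n = 0 := by
    have : |(n : ℝ)| < 1 := by
      have := abs_add_le ((n : ℝ) - s * α) (s * α)
      rw [sub_add_cancel] at this
      linarith
    exact Int.abs_lt_one_iff.mp (by exact_mod_cast this)
  subst hn
  have hm : m = 0 := by
    have hαβ : |s * α * (s * β)| ≤ 1 / 8 * (1 / 8) := by
      rw [abs_mul]
      gcongr
      linarith
    have : |(m : ℝ)| < 1 := by
      have h4 : |(m : ℝ) - s * γ + s * α * (s * β) / 2| < ε := by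
        have : (m : ℝ) - (s * γ + s * α * (s * β) / 2) + s * β * (s * α - (0 : ℤ)) =
          m - s * γ + s * α * (s * β) / 2 := by push_cast; ring
        rw [this] at hd
        exact (le_add_of_nonneg_left (add_nonneg h1 h2)).trans_lt hd
      rw [abs_lt] at h4 ⊢
      rw [abs_le] at hαβ hsγ
      constructor <;> linarith
    exact Int.abs_lt_one_iff.mp (by exact_mod_cast this)
  subst hm
  exact ha rfl

lemma abs_sub_mul_le (t x y : ℝ) : |y - t * x| ≤ |y| + |t| * |x| := by
  rw [← abs_mul]
  exact abs_sub _ _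

lemma not_recurrentAlong_thetaLine {t : ℝ} (ht : ∀ l : ℤ, (l : ℝ) ≠ t) :
    ¬ H3RecurrentAlong heisMeasure heisEquiv (thetaLine t) := by
  intro hrec
  obtain ⟨δ, hδ0, hδ⟩ : ∃ δ : ℝ, 0 < δ ∧
      ∀ i, δ ≤ |((dirSeq i).2 : ℝ) - t * (dirSeq i).1| := by
    have h0 : 0 < |t - round t| := abs_pos.mpr (sub_ne_zero.mpr (ht _).symm)
    refine ⟨min 1 |t - round t|, lt_min one_pos h0, fun i => ?_⟩
    unfold dirSeq
    rcases Denumerable.ofNat (Option ℤ) i.unpair.1 with _ | l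
    · simp [slopeVec]
    · refine (min_le_right _ _).trans ((round_le t l).trans ?_)
      simp [slopeVec, abs_sub_comm]
  obtain ⟨K, hK⟩ := exists_nat_gt (2 * (1 + |t|) / δ)
  rw [div_lt_iff₀ hδ0] at hK
  have ht0 := abs_nonneg t
  set E : Set (ℕ → Fin 2) := ⋂ i ∈ Finset.range K, {c | c i = 0} with hE
  have hEo : IsOpen E := isOpen_biInter_finset fun i _ =>
    (isOpen_discrete {(0 : Fin 2)}).preimage (continuous_apply (A := fun _ : ℕ => Fin 2) i)
  obtain ⟨a, ha, g, hg, hd, hpos⟩ := hrec (δ / (4 * (1 + |t|))) (by positivity) (cantorMap '' E)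
    (measurableEmbedding_cantorMap.measurableSet_image.mpr hEo.measurableSet)
    (heisMeasure_image_cantorMap_pos hEo.measurableSet
      (hEo.measure_pos _ ⟨0, by simp [hE]⟩))
  obtain ⟨s, rfl⟩ := (mem_expLine_mk _).mp hg
  obtain ⟨c, hc, c', hc', hcc⟩ := exists_of_measure_inter_image_pos hpos
  have ha2 := (of_heisAct_cantorMap_eq hcc).1
  have hN := exists_forall_eq_digitSum_sub hcc
  obtain ⟨n, b, m⟩ := a
  obtain rfl : b = 0 := ha2
  dsimp only at hN
  classical
  have hspec := Nat.find_spec hN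
  have hmin := fun k => Nat.find_min hN (m := k)
  generalize Nat.find hN = N at hspec hmin
  have hlast := hspec N le_rfl
  rcases N with _ | j
  · exact ha (by simpa [digitSum_zero, Prod.ext_iff] using hlast)
  have hne : c j ≠ c' j := by
    intro hj
    refine hmin j (Nat.lt_succ_self j) fun k hk => ?_
    rcases hk.eq_or_lt with rfl | hk
    · simpa [digitSum_succ, hj] using hlast
    · exact hspec k hk
  have hKj : K ≤ j := by
    by_contra! h
    simp only [hE, Set.mem_iInter, Finset.mem_range, Set.mem_ofPred_eq] at hc hc'
    exact hne ((hc j h).trans (hc' j h).symm)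
  obtain ⟨e, he, hed⟩ : ∃ e : ℝ, |e| = 1 ∧ ((c' j : ℕ) : ℝ) - ((c j : ℕ) : ℝ) = e := by
    refine ⟨_, ?_, rfl⟩
    have key : ∀ y z : Fin 2, y ≠ z → (y : ℕ) = 0 ∧ (z : ℕ) = 1 ∨ (y : ℕ) = 1 ∧ (z : ℕ) = 0 := by
      decide
    rcases key _ _ hne with ⟨h, h'⟩ | ⟨h, h'⟩ <;> simp [h, h']
  set P : ℤ := digitSum (fun i => (dirSeq i).1) c' j - digitSum (fun i => (dirSeq i).1) c j with hP
  set Q : ℤ := digitSum (fun i => (dirSeq i).2) c' j - digitSum (fun i => (dirSeq i).2) c j with hQ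
  have hPle : |(P : ℝ)| ≤ sizeSum j := by
    exact_mod_cast abs_digitSum_sub_le fst_natAbs_le c c' j
  have hQle : |(Q : ℝ)| ≤ sizeSum j := by
    exact_mod_cast abs_digitSum_sub_le snd_natAbs_le c c' j
  have hn : (n : ℝ) = P + e * (modulus j * (dirSeq j).1) := by
    rw [hlast.1, hP, digitSum_succ, digitSum_succ, ← hed]
    push_cast
    ring
  have hm : (m : ℝ) = Q + e * (modulus j * (dirSeq j).2) := by
    rw [hlast.2, hQ, digitSum_succ, digitSum_succ, ← hed]
    push_cast
    ring
  have hM1 : (1 : ℝ) ≤ modulus j := by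
    have := succ_le_modulus j
    exact_mod_cast (by omega : 1 ≤ modulus j)
  have hsize : ((K : ℝ) + 1) * sizeSum j ≤ modulus j := by
    refine le_trans ?_ (show ((j : ℝ) + 1) * sizeSum j ≤ modulus j by
      exact_mod_cast succ_mul_sizeSum_le j)
    gcongr
  have hupper : |(m : ℝ) - t * n| ≤ δ / 4 := by
    simp only [hDist, hCast, hExp, Prod.smul_mk, smul_eq_mul, Int.cast_zero, mul_one, mul_zero,
      sub_self, abs_zero, add_zero, zero_mul, zero_div] at hd
    have h1 := abs_nonneg ((n : ℝ) - s)
    have h2 := abs_nonneg ((m : ℝ) - s * t)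
    have h3 : (m : ℝ) - t * n = (m - s * t) - t * (n - s) := by ring
    have h4 : (1 + |t|) * (δ / (4 * (1 + |t|))) = δ / 4 := by field_simp
    rw [h3, ← h4]
    refine (abs_sub_mul_le _ _ _).trans ?_
    nlinarith
  have hlower : modulus j * δ ≤ |(m : ℝ) - t * n| + (1 + |t|) * sizeSum j := by
    have h1 : e * modulus j * ((dirSeq j).2 - t * (dirSeq j).1) = (m - t * n) - (Q - t * P) := by
      rw [hn, hm]
      ring
    calc modulus j * δ ≤ modulus j * |((dirSeq j).2 : ℝ) - t * (dirSeq j).1| := by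
          gcongr
          exact hδ j
      _ = |e * modulus j * ((dirSeq j).2 - t * (dirSeq j).1)| := by
          rw [abs_mul, abs_mul, he, one_mul, Nat.abs_cast]
      _ ≤ |(m : ℝ) - t * n| + |(Q : ℝ) - t * P| := by
          rw [h1]
          exact abs_sub _ _
      _ ≤ |(m : ℝ) - t * n| + (sizeSum j + |t| * sizeSum j) := by
          gcongr
          exact (abs_sub_mul_le _ _ _).trans (by gcongr)
      _ = _ := by ring
  have hS : 0 ≤ (sizeSum j : ℝ) := Nat.cast_nonneg _
  have h5 : 2 * (1 + |t|) * sizeSum j ≤ K * δ * sizeSum j := by gcongr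
  have h6 : K * sizeSum j * δ ≤ modulus j * δ := by
    gcongr
    linarith
  nlinarith

lemma eq_thetaLine_or_eq_thetaInf {α γ : ℝ} (hv : ((α, 0, γ) : ℝ × ℝ × ℝ) ≠ 0) :
    (∃ t, Projectivization.mk ℝ (α, 0, γ) hv = thetaLine t) ∨
      Projectivization.mk ℝ (α, 0, γ) hv = thetaInf := by
  by_cases hα : α = 0
  · subst hα
    refine Or.inr ((Projectivization.mk_eq_mk_iff' ..).mpr ⟨γ, by simp⟩)
  · refine Or.inl ⟨γ / α, (Projectivization.mk_eq_mk_iff' ..).mpr ⟨α, ?_⟩⟩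
    simp [mul_div_cancel₀ _ hα]

lemma h3RecSet_heisMeasure :
    h3RecSet heisMeasure heisEquiv =
      (Set.range fun l : ℤ => thetaLine (l : ℝ)) ∪ {thetaInf} := by
  refine Set.Subset.antisymm (fun θ hθ => ?_) ?_
  · obtain ⟨⟨α, β, γ⟩, hv, rfl⟩ : ∃ v, ∃ hv : v ≠ 0, θ = Projectivization.mk ℝ v hv :=
      ⟨θ.rep, θ.rep_nonzero, θ.mk_rep.symm⟩
    by_cases hβ : β = 0
    · subst hβ
      rcases eq_thetaLine_or_eq_thetaInf hv with ⟨t, h⟩ | h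
      · rw [h] at hθ ⊢
        by_contra hcon
        exact not_recurrentAlong_thetaLine (fun l hl => hcon (Or.inl ⟨l, by simp [hl]⟩)) hθ
      · exact Or.inr h
    · exact absurd hθ (not_recurrentAlong_of_snd_ne_zero hβ hv)
  · rintro θ (⟨l, rfl⟩ | rfl)
    · exact recurrentAlong_thetaLine l
    · exact recurrentAlong_thetaInf

lemma adjProj_thetaInf (g : ℝ × ℝ × ℝ) : adjProj g thetaInf = thetaInf := by
  refine (Projectivization.mk_eq_mk_iff' ..).mpr ⟨1, ?_⟩
  simp [adjLin]

lemma adjProj_thetaLine (y t : ℝ) : adjProj (0, y, 0) (thetaLine t) = thetaLine (t - y) := by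
  refine (Projectivization.mk_eq_mk_iff' ..).mpr ⟨1, ?_⟩
  simp [adjLin]

lemma adjProj_zero (θ : Projectivization ℝ (ℝ × ℝ × ℝ)) : adjProj 0 θ = θ := by
  induction θ with
  | h v hv =>
    refine (Projectivization.mk_eq_mk_iff' ..).mpr ⟨1, ?_⟩
    simp [adjLin]

lemma thetaLine_ne_thetaInf (t : ℝ) : thetaLine t ≠ thetaInf := by
  intro h
  obtain ⟨s, hs⟩ := (Projectivization.mk_eq_mk_iff' ..).mp h
  simpa using congrArg Prod.fst hs

lemma setOf_evenRecurrentAlong_heisMeasure :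
    {θ | H3EvenRecurrentAlong heisMeasure heisEquiv θ} = {thetaInf} := by
  refine Set.Subset.antisymm (fun θ hθ => ?_) ?_
  · have h0 : θ ∈ h3RecSet heisMeasure heisEquiv := by
      have := hθ 0
      rwa [adjProj_zero] at this
    rw [h3RecSet_heisMeasure] at h0
    rcases h0 with ⟨l, rfl⟩ | h0
    · have h1 := hθ (0, 1 / 2, 0)
      rw [adjProj_thetaLine] at h1
      refine absurd h1 (not_recurrentAlong_thetaLine fun k hk => ?_)
      have h2 : (2 * k : ℝ) = 2 * l - 1 := by linarith
      have h3 : 2 * k = 2 * l - 1 := by exact_mod_cast h2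
      omega
    · exact h0
  · rintro _ rfl g
    rw [adjProj_thetaInf]
    exact recurrentAlong_thetaInf

/-- there is a free infinite measure preserving action `T` of `H₃(ℤ)` with
`𝓡(T) = {θ_l : l ∈ ℤ} ∪ {θ_∞}`; consequently `𝓔𝓡(T) = {θ_∞}` and `𝓡(T) ≠ 𝓔𝓡(T)`. -/
theorem exists_h3_action_countable_recurrence_set :
    ∃ (X : Type) (_ : MeasurableSpace X), StandardBorelSpace X ∧
      ∃ μ : Measure X, SigmaFinite μ ∧ μ Set.univ = ⊤ ∧
        ∃ T : ℤ × ℤ × ℤ → X ≃ᵐ X, IsH3Action μ T ∧ IsH3Free μ T ∧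
          h3RecSet μ T = (Set.range fun l : ℤ => thetaLine (l : ℝ)) ∪ {thetaInf} ∧
          {θ | H3EvenRecurrentAlong μ T θ} = {thetaInf} ∧
          h3RecSet μ T ≠ {θ | H3EvenRecurrentAlong μ T θ} := by
  refine ⟨ModRing × ModRing × ModRing, inferInstance, inferInstance, heisMeasure, inferInstance,
    heisMeasure_univ, heisEquiv, ⟨heisAct_hMul, measurePreserving_heisEquiv⟩,
    fun a ha => Eventually.of_forall (heisAct_ne ha), h3RecSet_heisMeasure,
    setOf_evenRecurrentAlong_heisMeasure, fun h => ?_⟩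
  rw [setOf_evenRecurrentAlong_heisMeasure, h3RecSet_heisMeasure] at h
  have h0 : thetaLine ((0 : ℤ) : ℝ) ∈ ({thetaInf} : Set (Projectivization ℝ (ℝ × ℝ × ℝ))) :=
    h ▸ Or.inl ⟨0, rfl⟩
  exact thetaLine_ne_thetaInf _ h0
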